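/- Let G be a multi-GGS-group that is not the GGS-group 𝒢 defined by a constant vector. Then ψ(G′ ∩ st(1)) is a subdirect subgroup of G × ⋯ × G (p factors); that is, for every j ∈ {1,…,p}, the j-th coordinate projection maps ψ(G′ ∩ st(1)) onto G. -/

import Mathlib

/-!
Automorphisms of the `p`-regular rooted tree, encoded by portraits:
an automorphism is a family of permutations of `Fin p`, one for each vertex
(vertices are finite words over `Fin p`, the root being `[]`).
-/

namespace TreeAut

variable {p : ℕ}

/-- Automorphisms of the `p`-regular rooted tree, given by their portraits. -/
def AutT (p : ℕ) : Type := List (Fin p) → Equiv.Perm (Fin p)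

namespace AutT

/-- The action of a tree automorphism on the vertices (finite words over `Fin p`). -/
def act : AutT p → List (Fin p) → List (Fin p)
  | _, [] => []
  | f, x :: w => f [] x :: act (fun v => f (x :: v)) w

/-- The section of `f` at the level-one vertex `x`; the map
`f ↦ (sections f 0, …, sections f (p-1))` restricted to the first-level
stabilizer is the isomorphism `ψ`. -/
def sections (f : AutT p) : Fin p → AutT p := fun x v => f (x :: v)

instance : One (AutT p) := ⟨fun _ => 1⟩

instance : Mul (AutT p) := ⟨fun f g v => f (act g v) * g v⟩

/-- The action of the inverse automorphism on vertices. -/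
def invAct : AutT p → List (Fin p) → List (Fin p)
  | _, [] => []
  | f, x :: w => (f [])⁻¹ x :: invAct (fun v => f (((f [])⁻¹ x) :: v)) w

instance : Inv (AutT p) := ⟨fun f v => (f (invAct f v))⁻¹⟩

lemma one_apply (v : List (Fin p)) : (1 : AutT p) v = 1 := rfl

lemma mul_apply (f g : AutT p) (v : List (Fin p)) : (f * g) v = f (act g v) * g v := rfl

lemma inv_apply (f : AutT p) (v : List (Fin p)) : f⁻¹ v = (f (invAct f v))⁻¹ := rfl

lemma act_nil (f : AutT p) : act f [] = [] := rfl

lemma act_cons (f : AutT p) (x : Fin p) (w : List (Fin p)) :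
    act f (x :: w) = f [] x :: act (sections f x) w := rfl

lemma sections_mul (f g : AutT p) (x : Fin p) :
    sections (f * g) x = sections f (g [] x) * sections g x :=
  funext fun _ => rfl

lemma act_one : ∀ v : List (Fin p), act (1 : AutT p) v = v
  | [] => rfl
  | x :: w => congrArg (x :: ·) (act_one w)

lemma act_mul (f g : AutT p) : ∀ v : List (Fin p), act (f * g) v = act f (act g v)
  | [] => rfl
  | x :: w => by
      rw [act_cons (f * g), sections_mul, act_mul, act_cons g, act_cons f]
      rfl

lemma invAct_act (f : AutT p) : ∀ v : List (Fin p), invAct f (act f v) = v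
  | [] => rfl
  | x :: w => by
      rw [act_cons]
      show (f [])⁻¹ (f [] x) ::
          invAct (fun v => f (((f [])⁻¹ (f [] x)) :: v)) (act (sections f x) w) = x :: w
      rw [show (f [])⁻¹ (f [] x) = x from Equiv.symm_apply_apply (f []) x]
      exact congrArg (x :: ·) (invAct_act (sections f x) w)

instance : Group (AutT p) where
  mul_assoc f g h := by
    funext v
    show (f * g) (act h v) * h v = f (act (g * h) v) * (g * h) v
    rw [mul_apply, mul_apply, act_mul, mul_assoc]
  one_mul f := by
    funext v
    show (1 : AutT p) (act f v) * f v = f v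
    rw [one_apply, one_mul]
  mul_one f := by
    funext v
    show f (act (1 : AutT p) v) * (1 : AutT p) v = f v
    rw [act_one, one_apply, mul_one]
  inv_mul_cancel f := by
    funext v
    show f⁻¹ (act f v) * f v = (1 : AutT p) v
    rw [inv_apply, invAct_act, one_apply, inv_mul_cancel]

lemma act_length (f : AutT p) : ∀ v : List (Fin p), (act f v).length = v.length
  | [] => rfl
  | _ :: w => congrArg Nat.succ (act_length _ w)

lemma act_act_inv (f : AutT p) (v : List (Fin p)) : act f (act f⁻¹ v) = v := by
  rw [← act_mul, mul_inv_cancel, act_one]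

/-- The pointwise stabilizer `st(n)` of the `n`-th level of the tree. -/
def levelStab (p n : ℕ) : Subgroup (AutT p) where
  carrier := {f | ∀ v : List (Fin p), v.length = n → act f v = v}
  one_mem' := fun v _ => act_one v
  mul_mem' := by
    intro f g hf hg v hv
    rw [act_mul, hg v hv, hf v hv]
  inv_mem' := by
    intro f hf v hv
    have h1 : act f (act f⁻¹ v) = v := act_act_inv f v
    have h2 : act f (act f⁻¹ v) = act f⁻¹ v := hf _ (by rw [act_length, hv])
    exact h2.symm.trans h1

instance levelStab_normal (p n : ℕ) : (levelStab p n).Normal := by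
  constructor
  intro f hf g v hv
  show act (g * f * g⁻¹) v = v
  rw [act_mul, act_mul, hf _ (by rw [act_length, hv]), act_act_inv]

/-- The tuple of sections at the level-two vertices.  Restricted to the
second-level stabilizer this is the map `ψ₂`. -/
def sections2 (f : AutT p) : Fin p → Fin p → AutT p := fun x y v => f (x :: y :: v)

/-- The rooted automorphism defined by a permutation `σ` of `Fin p`. -/
def rooted (σ : Equiv.Perm (Fin p)) : AutT p := fun v => if v = [] then σ else 1

/-- The rooted automorphism `a`, acting at the root by the cycle `(1 2 … p)`. -/
def rootedA (p : ℕ) : AutT p := rooted (finRotate p)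

/-- Auxiliary portrait for the directed automorphism `b_e`. -/
def directedAux (e : Fin (p - 1) → ZMod p) : List (Fin p) → Equiv.Perm (Fin p)
  | [] => 1
  | x :: w =>
      if h : (x : ℕ) < p - 1 then
        (if w = [] then finRotate p ^ ((e ⟨x, h⟩).val) else 1)
      else directedAux e w

/-- The directed automorphism `b_e` defined by the vector `e ∈ 𝔽_p^{p-1}`,
i.e. the unique automorphism with `ψ(b_e) = (a^{e_1}, …, a^{e_{p-1}}, b_e)`. -/
def directed (e : Fin (p - 1) → ZMod p) : AutT p := directedAux e

/-- The multi-GGS-group determined by the vectors `e 1, …, e r`. -/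
def multiGGS (p : ℕ) {r : ℕ} (e : Fin r → Fin (p - 1) → ZMod p) : Subgroup (AutT p) :=
  Subgroup.closure ({rootedA p} ∪ Set.range fun i => directed (e i))

/-- The GGS-group `𝒢` defined by the (nonzero) constant vector `(c, …, c)`. -/
def constGGS (p : ℕ) (c : ZMod p) : Subgroup (AutT p) :=
  Subgroup.closure {rootedA p, directed (fun _ => c)}

/-- `G` is the GGS-group `𝒢` defined by a constant vector. -/
def IsConstGGS {p : ℕ} (G : Subgroup (AutT p)) : Prop :=
  ∃ c : ZMod p, c ≠ 0 ∧ G = constGGS p c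

/-- The stabilizer `st_G(n) = G ∩ st(n)`, viewed as a subgroup of `G`. -/
def stabIn {p : ℕ} (G : Subgroup (AutT p)) (n : ℕ) : Subgroup G :=
  (levelStab p n).comap G.subtype

instance {p : ℕ} (G : Subgroup (AutT p)) (n : ℕ) : (stabIn G n).Normal :=
  Subgroup.Normal.comap (levelStab_normal p n) G.subtype

/-- The congruence subgroup property: every finite-index subgroup of `G`
contains a level stabilizer `st_G(n)`. -/
def HasCSP {p : ℕ} (G : Subgroup (AutT p)) : Prop :=
  ∀ H : Subgroup G, H.FiniteIndex → ∃ n : ℕ, stabIn G n ≤ H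

/-- `G` is just infinite: it is infinite and all its nontrivial normal
subgroups have finite index. -/
def JustInfinite {p : ℕ} (G : Subgroup (AutT p)) : Prop :=
  Infinite G ∧ ∀ N : Subgroup G, N.Normal → N ≠ ⊥ → N.FiniteIndex

end AutT

end TreeAut

namespace TreeAut

namespace AutT

variable {p : ℕ}

lemma sections_one (x : Fin p) : sections (1 : AutT p) x = 1 := rfl

lemma sections_inv (f : AutT p) (x : Fin p) :
    sections f⁻¹ x = (sections f (f⁻¹ [] x))⁻¹ :=
  eq_inv_of_mul_eq_one_right (by rw [← sections_mul, mul_inv_cancel, sections_one])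

lemma apply_nil_of_mem_levelStab_one {f : AutT p} (hf : f ∈ levelStab p 1) (x : Fin p) :
    f [] x = x :=
  (List.cons.inj (hf [x] rfl)).1

lemma mem_levelStab_one {f : AutT p} (hf : f [] = 1) : f ∈ levelStab p 1 := by
  intro v hv
  obtain ⟨x, rfl⟩ := List.length_eq_one_iff.mp hv
  rw [act_cons, hf, act_nil, Equiv.Perm.one_apply]

/-- The `j`-th coordinate of `ψ`, as a homomorphism on the first-level stabilizer. -/
def sectionHom (j : Fin p) : levelStab p 1 →* AutT p where
  toFun f := sections f j
  map_one' := rfl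
  map_mul' f g := by
    rw [Subgroup.coe_mul, sections_mul, apply_nil_of_mem_levelStab_one g.2]

lemma sections_rooted (σ : Equiv.Perm (Fin p)) (x : Fin p) : sections (rooted σ) x = 1 :=
  rfl

/-- Rooted automorphisms form a copy of the symmetric group. -/
def rootedHom : Equiv.Perm (Fin p) →* AutT p where
  toFun := rooted
  map_one' := funext fun v => ite_self (c := v = []) 1
  map_mul' σ τ := by
    funext v
    cases v with
    | nil => rfl
    | cons x w => rfl

lemma rootedHom_nil (σ : Equiv.Perm (Fin p)) : rootedHom σ [] = σ := rfl

lemma sections_rootedHom (σ : Equiv.Perm (Fin p)) (x : Fin p) :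
    sections (rootedHom σ) x = 1 :=
  sections_rooted σ x

lemma directed_nil (e : Fin (p - 1) → ZMod p) : directed e [] = 1 := rfl

lemma sections_directed_of_lt (e : Fin (p - 1) → ZMod p) (x : Fin p) (h : (x : ℕ) < p - 1) :
    sections (directed e) x = rootedA p ^ (e ⟨x, h⟩).val := by
  have hr : rootedA p ^ (e ⟨x, h⟩).val = rooted (finRotate p ^ (e ⟨x, h⟩).val) :=
    (map_pow rootedHom _ _).symm
  rw [hr]
  exact funext fun _ => dif_pos h

lemma sections_directed_of_not_lt (e : Fin (p - 1) → ZMod p) (x : Fin p)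
    (h : ¬ (x : ℕ) < p - 1) : sections (directed e) x = directed e :=
  funext fun _ => dif_neg h

lemma exists_zpow_finRotate_apply (x y : Fin p) : ∃ k : ℤ, (finRotate p ^ k) x = y := by
  match p, x, y with
  | 1, x, y => exact ⟨0, Subsingleton.elim _ _⟩
  | n + 2, x, y =>
    have hmem (z : Fin (n + 2)) : finRotate (n + 2) z ≠ z := by
      rw [← Equiv.Perm.mem_support, support_finRotate]
      exact Finset.mem_univ z
    exact isCycle_finRotate.sameCycle (hmem x) (hmem y)

lemma rootedA_pow_self : rootedA p ^ p = 1 := by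
  have h : finRotate p ^ p = 1 := by
    match p with
    | 0 => rfl
    | 1 => exact Subsingleton.elim _ _
    | n + 2 =>
      have h := pow_orderOf_eq_one (finRotate (n + 2))
      rwa [isCycle_finRotate.orderOf, support_finRotate, Finset.card_univ,
        Fintype.card_fin] at h
  change rootedHom (finRotate p) ^ p = 1
  rw [← map_pow, h, map_one]

section multiGGS

variable {r : ℕ} (e : Fin r → Fin (p - 1) → ZMod p)

lemma rootedA_mem_multiGGS : rootedA p ∈ multiGGS p e :=
  Subgroup.subset_closure (Or.inl rfl)

lemma directed_mem_multiGGS (i : Fin r) : directed (e i) ∈ multiGGS p e :=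
  Subgroup.subset_closure (Or.inr ⟨i, rfl⟩)

lemma sections_mem_multiGGS {f : AutT p} (hf : f ∈ multiGGS p e) (x : Fin p) :
    sections f x ∈ multiGGS p e := by
  induction hf using Subgroup.closure_induction generalizing x with
  | mem f hf =>
    rcases hf with rfl | ⟨i, rfl⟩
    · rw [rootedA, sections_rooted]
      exact one_mem _
    · by_cases h : (x : ℕ) < p - 1
      · rw [sections_directed_of_lt _ _ h]
        exact pow_mem (rootedA_mem_multiGGS e) _
      · rw [sections_directed_of_not_lt _ _ h]
        exact directed_mem_multiGGS e i
  | one => exact one_mem _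
  | mul f g _ _ hf hg =>
    rw [sections_mul]
    exact mul_mem (hf _) (hg x)
  | inv f _ hf =>
    rw [sections_inv]
    exact inv_mem (hf _)

/-- The projection of `ψ(G' ∩ st(1))` to the `j`-th coordinate, for `G = multiGGS p e`. -/
def derivedProj (j : Fin p) : Subgroup (AutT p) :=
  (⁅multiGGS p e, multiGGS p e⁆.subgroupOf (levelStab p 1)).map (sectionHom j)

lemma coe_derivedProj (j : Fin p) :
    (derivedProj e j : Set (AutT p)) = (fun f => sections f j) ''
      ((⁅multiGGS p e, multiGGS p e⁆ ⊓ levelStab p 1 : Subgroup (AutT p)) : Set (AutT p)) := by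
  ext g
  constructor
  · rintro ⟨f, hf, rfl⟩
    exact ⟨f, ⟨hf, f.2⟩, rfl⟩
  · rintro ⟨f, ⟨hf, hs⟩, rfl⟩
    exact ⟨⟨f, hs⟩, hf, rfl⟩

lemma sections_directed_mul_inv_mem_derivedProj (i : Fin r) (x y j : Fin p) :
    sections (directed (e i)) x * (sections (directed (e i)) y)⁻¹ ∈ derivedProj e j := by
  set b := directed (e i)
  have hbs : b ∈ levelStab p 1 := mem_levelStab_one (directed_nil _)
  have key (x : Fin p) : ∃ g : levelStab p 1,
      (g : AutT p) * b⁻¹ ∈ ⁅multiGGS p e, multiGGS p e⁆ ∧ sectionHom j g = sections b x := by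
    obtain ⟨k, hk⟩ := exists_zpow_finRotate_apply j x
    set t : AutT p := rootedHom (finRotate p ^ k) with ht
    have htG : t ∈ multiGGS p e := by
      rw [ht, map_zpow]
      exact zpow_mem (rootedA_mem_multiGGS e) k
    have hinv : t⁻¹ = rootedHom (finRotate p ^ k)⁻¹ := (map_inv _ _).symm
    refine ⟨⟨t⁻¹ * b * t, ?_⟩, ?_, ?_⟩
    · simpa using (levelStab_normal p 1).conj_mem b hbs t⁻¹
    · have h := Subgroup.commutator_mem_commutator (inv_mem htG) (directed_mem_multiGGS e i)
      rwa [commutatorElement_def, inv_inv] at h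
    · change sections (t⁻¹ * b * t) j = sections b x
      rw [sections_mul, sections_mul, hinv, sections_rootedHom, ht, sections_rootedHom,
        rootedHom_nil, hk, one_mul, mul_one]
  obtain ⟨g, hg, hgx⟩ := key x
  obtain ⟨h, hh, hhy⟩ := key y
  refine ⟨g * h⁻¹, ?_, by rw [map_mul, map_inv, hgx, hhy]⟩
  change (g : AutT p) * (h : AutT p)⁻¹ ∈ ⁅multiGGS p e, multiGGS p e⁆
  simpa using mul_mem hg (inv_mem hh)

lemma rootedA_mem_derivedProj (hp : p.Prime) {i : Fin r} {x y : Fin (p - 1)}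
    (hxy : e i x ≠ e i y) (j : Fin p) : rootedA p ∈ derivedProj e j := by
  have hlt (z : Fin (p - 1)) : (z : ℕ) < p := z.2.trans_le (Nat.sub_le p 1)
  have h := sections_directed_mul_inv_mem_derivedProj e i ⟨x, hlt x⟩ ⟨y, hlt y⟩ j
  rw [sections_directed_of_lt _ _ x.2, sections_directed_of_lt _ _ y.2] at h
  change rootedA p ^ (e i x).val * (rootedA p ^ (e i y).val)⁻¹ ∈ _ at h
  rw [← zpow_natCast, ← zpow_natCast, ← zpow_neg, ← zpow_add] at h
  have hcop : IsCoprime (p : ℤ) ((e i x).val + -((e i y).val : ℤ)) := by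
    rw [(Nat.prime_iff_prime_int.mp hp).coprime_iff_not_dvd, ← ZMod.intCast_zmod_eq_zero_iff_dvd]
    have : NeZero p := ⟨hp.ne_zero⟩
    push_cast
    rw [ZMod.natCast_zmod_val, ZMod.natCast_zmod_val, ← sub_eq_add_neg]
    exact sub_ne_zero.mpr hxy
  obtain ⟨u, v, huv⟩ := hcop
  have hpow := zpow_mem h v
  rw [← zpow_mul, mul_comm] at hpow
  have hone : rootedA p = rootedA p ^ (u * p + v * ((e i x).val + -((e i y).val : ℤ))) := by
    rw [huv, zpow_one]
  rw [hone, zpow_add, mul_comm u, zpow_mul, zpow_natCast, rootedA_pow_self, one_zpow, one_mul]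
  exact hpow

lemma multiGGS_le_derivedProj (hp : p.Prime) {i : Fin r} {x y : Fin (p - 1)}
    (hxy : e i x ≠ e i y) (j : Fin p) : multiGGS p e ≤ derivedProj e j := by
  have ha := rootedA_mem_derivedProj e hp hxy j
  rw [multiGGS, Subgroup.closure_le]
  rintro _ (rfl | ⟨k, rfl⟩)
  · exact ha
  · have hx : (x : ℕ) < p := x.2.trans_le (Nat.sub_le p 1)
    have h := sections_directed_mul_inv_mem_derivedProj e k
      ⟨p - 1, Nat.sub_lt hp.pos one_pos⟩ ⟨x, hx⟩ j
    rw [sections_directed_of_not_lt _ _ (lt_irrefl _), sections_directed_of_lt _ _ x.2] at h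
    simpa using mul_mem h (pow_mem ha (e k x).val)

lemma isConstGGS_of_forall_eq (hp : p.Prime) (hr : 1 ≤ r) (he : LinearIndependent (ZMod p) e)
    (hconst : ∀ i x y, e i x = e i y) : IsConstGGS (multiGGS p e) := by
  have : Fact p.Prime := ⟨hp⟩
  have hpos : 0 < p - 1 := Nat.sub_pos_of_lt hp.one_lt
  have hfun (i : Fin r) : e i = fun _ => e i ⟨0, hpos⟩ := funext fun x => hconst i x _
  have hne (i : Fin r) : e i ⟨0, hpos⟩ ≠ 0 := fun h0 =>
    he.ne_zero i ((hfun i).trans (funext fun _ => h0))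
  let i₀ : Fin r := ⟨0, hr⟩
  have hall (i : Fin r) : i = i₀ :=
    he.eq_of_smul_apply_eq_smul_apply (e i₀ ⟨0, hpos⟩) (e i ⟨0, hpos⟩) i i₀ (hne i₀) <| by
      funext x
      rw [Pi.smul_apply, Pi.smul_apply, smul_eq_mul, smul_eq_mul, hconst i x ⟨0, hpos⟩,
        hconst i₀ x ⟨0, hpos⟩, mul_comm]
  refine ⟨e i₀ ⟨0, hpos⟩, hne i₀, ?_⟩
  rw [multiGGS, constGGS, ← hfun i₀]
  congr 1
  ext f
  constructor
  · rintro (rfl | ⟨i, rfl⟩)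
    · exact Or.inl rfl
    · rw [hall i]
      exact Or.inr rfl
  · rintro (rfl | rfl)
    · exact Or.inl rfl
    · exact Or.inr ⟨i₀, rfl⟩

end multiGGS

end AutT

end TreeAut

open TreeAut AutT Subgroup

/-- If the multi-GGS-group `G` is not the constant GGS-group `𝒢`, then
`ψ(G' ∩ st(1))` is a subdirect subgroup of `G × ⋯ × G`: each coordinate
projection maps it onto `G`. -/
theorem derived_subdirect_of_not_constGGS
    (p r : ℕ) (hp : p.Prime) (hpodd : Odd p) (hr : 1 ≤ r)
    (e : Fin r → Fin (p - 1) → ZMod p) (he : LinearIndependent (ZMod p) e)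
    (hG : ¬ IsConstGGS (multiGGS p e)) :
    ∀ j : Fin p,
      (fun f => sections f j) ''
          ((⁅multiGGS p e, multiGGS p e⁆ ⊓ levelStab p 1 : Subgroup (AutT p)) : Set (AutT p))
        = ((multiGGS p e : Subgroup (AutT p)) : Set (AutT p)) := by
  intro j
  rw [← coe_derivedProj]
  obtain ⟨i, x, y, hxy⟩ : ∃ i x y, e i x ≠ e i y := by
    by_contra! hconst
    exact hG (isConstGGS_of_forall_eq e hp hr he hconst)
  refine Set.Subset.antisymm ?_ (multiGGS_le_derivedProj e hp hxy j)
  rintro _ ⟨f, hf, rfl⟩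
  exact sections_mem_multiGGS e (Subgroup.commutator_le_self _ hf) j
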